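/- arXiv:2204.01120 — 2 statements merged into one kernel-verified Lean document; each statement's English description precedes it below -/
import Mathlib

section
/- Fix n ≥ 1, let P ∈ (ℝ²)ⁿ, let o(P) be the minimizer of the egalitarian social cost C^e(·, P), and let ô ∈ ℝ² be any prediction. Then C^e(MBB(P, ô), P) ≤ OPT^e(P) + min{‖ô − o(P)‖, √2 · OPT^e(P)}. Equivalently, when OPT^e(P) > 0 and the prediction error is η = ‖ô − o(P)‖ / OPT^e(P), the Minimum Bounding Box mechanism achieves a min{1 + η, 1 + √2} approximation of the optimal egalitarian social cost. -/
/-- Euclidean distance on the plane. -/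
noncomputable def eudist (a b : ℝ × ℝ) : ℝ :=
  Real.sqrt ((a.1 - b.1) ^ 2 + (a.2 - b.2) ^ 2)

/-- Egalitarian social cost: the maximum distance from `y` to the points of `P`. -/
noncomputable def Ce {n : ℕ} (y : ℝ × ℝ) (P : Fin n → ℝ × ℝ) : ℝ :=
  ⨆ i, eudist y (P i)

/-- The Minimum Bounding Box mechanism: the prediction clamped coordinatewise to
the minimum axis-parallel bounding box of the reported points. -/
noncomputable def MBB {n : ℕ} (P : Fin n → ℝ × ℝ) (oh : ℝ × ℝ) : ℝ × ℝ :=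
  (max (⨅ i, (P i).1) (min (⨆ i, (P i).1) oh.1),
   max (⨅ i, (P i).2) (min (⨆ i, (P i).2) oh.2))

theorem eudist_eq_dist (a b : ℝ × ℝ) :
    eudist a b = dist (WithLp.toLp 2 a) (WithLp.toLp 2 b) := by
  rw [WithLp.prod_dist_eq_of_L2]
  simp [eudist, Real.dist_eq, sq_abs]

theorem eudist_nonneg (a b : ℝ × ℝ) : 0 ≤ eudist a b := Real.sqrt_nonneg _

theorem eudist_sq (a b : ℝ × ℝ) :
    eudist a b ^ 2 = (a.1 - b.1) ^ 2 + (a.2 - b.2) ^ 2 :=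
  Real.sq_sqrt (by positivity)

theorem eudist_triangle (a b c : ℝ × ℝ) : eudist a c ≤ eudist a b + eudist b c := by
  simp only [eudist_eq_dist]
  exact dist_triangle _ _ _

theorem eudist_le_Ce {n : ℕ} (y : ℝ × ℝ) (P : Fin n → ℝ × ℝ) (i : Fin n) :
    eudist y (P i) ≤ Ce y P :=
  le_ciSup (f := fun i => eudist y (P i)) (Set.finite_range _).bddAbove i

theorem clamp_mem_Icc {l u : ℝ} (h : l ≤ u) (t : ℝ) :
    max l (min u t) ∈ Set.Icc l u :=
  ⟨le_max_left _ _, max_le h (min_le_left _ _)⟩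

/-- Clamping a real number to an interval satisfies the obtuse angle property of projections. -/
theorem clamp_sq_add_sq_le {l u x : ℝ} (hl : l ≤ x) (hu : x ≤ u) (t : ℝ) :
    (max l (min u t) - x) ^ 2 + (t - max l (min u t)) ^ 2 ≤ (t - x) ^ 2 := by
  rcases le_total u t with h | h
  · rw [min_eq_left h, max_eq_right (hl.trans hu)]
    nlinarith
  · rw [min_eq_right h]
    rcases le_total l t with h' | h'
    · rw [max_eq_right h']
      simp
    · rw [max_eq_left h']
      nlinarith

theorem ciInf_fst_le_and_le_ciSup {n : ℕ} (P : Fin n → ℝ × ℝ) (i : Fin n) :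
    (⨅ j, (P j).1) ≤ (P i).1 ∧ (P i).1 ≤ ⨆ j, (P j).1 :=
  ⟨ciInf_le (f := fun j => (P j).1) (Set.finite_range _).bddBelow i,
    le_ciSup (f := fun j => (P j).1) (Set.finite_range _).bddAbove i⟩

theorem ciInf_snd_le_and_le_ciSup {n : ℕ} (P : Fin n → ℝ × ℝ) (i : Fin n) :
    (⨅ j, (P j).2) ≤ (P i).2 ∧ (P i).2 ≤ ⨆ j, (P j).2 :=
  ⟨ciInf_le (f := fun j => (P j).2) (Set.finite_range _).bddBelow i,
    le_ciSup (f := fun j => (P j).2) (Set.finite_range _).bddAbove i⟩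

theorem MBB_fst_mem_Icc {n : ℕ} [Nonempty (Fin n)] (P : Fin n → ℝ × ℝ) (oh : ℝ × ℝ) :
    (MBB P oh).1 ∈ Set.Icc (⨅ j, (P j).1) (⨆ j, (P j).1) :=
  have h := ciInf_fst_le_and_le_ciSup P (Classical.arbitrary _)
  clamp_mem_Icc (h.1.trans h.2) oh.1

theorem MBB_snd_mem_Icc {n : ℕ} [Nonempty (Fin n)] (P : Fin n → ℝ × ℝ) (oh : ℝ × ℝ) :
    (MBB P oh).2 ∈ Set.Icc (⨅ j, (P j).2) (⨆ j, (P j).2) :=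
  have h := ciInf_snd_le_and_le_ciSup P (Classical.arbitrary _)
  clamp_mem_Icc (h.1.trans h.2) oh.2

/-- A minimizer of the egalitarian cost lies in the bounding box. -/
theorem MBB_eq_self_of_forall_Ce_le {n : ℕ} [Nonempty (Fin n)] (P : Fin n → ℝ × ℝ) (o : ℝ × ℝ)
    (ho : ∀ y : ℝ × ℝ, Ce o P ≤ Ce y P) : MBB P o = o := by
  obtain ⟨i, hi⟩ := exists_eq_ciSup_of_finite (f := fun i => eudist (MBB P o) (P i))
  have h1 : Ce o P ≤ eudist (MBB P o) (P i) := (ho (MBB P o)).trans_eq hi.symm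
  have h2 : eudist o (P i) ≤ eudist (MBB P o) (P i) := (eudist_le_Ce o P i).trans h1
  have h3 := pow_le_pow_left₀ (eudist_nonneg _ _) h2 2
  rw [eudist_sq, eudist_sq] at h3
  have hx : ((MBB P o).1 - (P i).1) ^ 2 + (o.1 - (MBB P o).1) ^ 2 ≤ (o.1 - (P i).1) ^ 2 :=
    clamp_sq_add_sq_le (ciInf_fst_le_and_le_ciSup P i).1 (ciInf_fst_le_and_le_ciSup P i).2 o.1
  have hy : ((MBB P o).2 - (P i).2) ^ 2 + (o.2 - (MBB P o).2) ^ 2 ≤ (o.2 - (P i).2) ^ 2 :=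
    clamp_sq_add_sq_le (ciInf_snd_le_and_le_ciSup P i).1 (ciInf_snd_le_and_le_ciSup P i).2 o.2
  have ex : (o.1 - (MBB P o).1) ^ 2 = 0 := by
    linarith [sq_nonneg (o.1 - (MBB P o).1), sq_nonneg (o.2 - (MBB P o).2)]
  have ey : (o.2 - (MBB P o).2) ^ 2 = 0 := by
    linarith [sq_nonneg (o.1 - (MBB P o).1), sq_nonneg (o.2 - (MBB P o).2)]
  exact Prod.ext (sub_eq_zero.1 (pow_eq_zero_iff two_ne_zero |>.1 ex)).symm
    (sub_eq_zero.1 (pow_eq_zero_iff two_ne_zero |>.1 ey)).symm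

/-- The mechanism does not move the prediction away from any point of the bounding box. -/
theorem eudist_MBB_le {n : ℕ} [Nonempty (Fin n)] (P : Fin n → ℝ × ℝ) (o oh : ℝ × ℝ)
    (ho : MBB P o = o) : eudist (MBB P oh) o ≤ eudist oh o := by
  have hox : o.1 ∈ Set.Icc (⨅ j, (P j).1) (⨆ j, (P j).1) := by
    simpa only [ho] using MBB_fst_mem_Icc P o
  have hoy : o.2 ∈ Set.Icc (⨅ j, (P j).2) (⨆ j, (P j).2) := by
    simpa only [ho] using MBB_snd_mem_Icc P o
  have hx : ((MBB P oh).1 - o.1) ^ 2 + (oh.1 - (MBB P oh).1) ^ 2 ≤ (oh.1 - o.1) ^ 2 :=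
    clamp_sq_add_sq_le hox.1 hox.2 oh.1
  have hy : ((MBB P oh).2 - o.2) ^ 2 + (oh.2 - (MBB P oh).2) ^ 2 ≤ (oh.2 - o.2) ^ 2 :=
    clamp_sq_add_sq_le hoy.1 hoy.2 oh.2
  apply Real.sqrt_le_sqrt
  linarith [sq_nonneg (oh.1 - (MBB P oh).1), sq_nonneg (oh.2 - (MBB P oh).2)]

theorem abs_fst_sub_le_eudist (a b : ℝ × ℝ) : |a.1 - b.1| ≤ eudist a b :=
  Real.abs_le_sqrt (by linarith [sq_nonneg (a.2 - b.2)])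

theorem abs_snd_sub_le_eudist (a b : ℝ × ℝ) : |a.2 - b.2| ≤ eudist a b :=
  Real.abs_le_sqrt (by linarith [sq_nonneg (a.1 - b.1)])

/-- The bounding box lies in the square of half-side `Ce o P` around `o`. -/
theorem eudist_MBB_le_sqrt_two_mul {n : ℕ} [Nonempty (Fin n)] (P : Fin n → ℝ × ℝ)
    (o oh : ℝ × ℝ) : eudist (MBB P oh) o ≤ Real.sqrt 2 * Ce o P := by
  have hx i := abs_le.1 ((abs_fst_sub_le_eudist o (P i)).trans (eudist_le_Ce o P i))
  have hy i := abs_le.1 ((abs_snd_sub_le_eudist o (P i)).trans (eudist_le_Ce o P i))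
  have i : Fin n := Classical.arbitrary _
  have hR : 0 ≤ Ce o P := (eudist_nonneg o (P i)).trans (eudist_le_Ce o P i)
  have mx := MBB_fst_mem_Icc P oh
  have my := MBB_snd_mem_Icc P oh
  have lx : o.1 - Ce o P ≤ ⨅ j, (P j).1 := le_ciInf fun j => by linarith [(hx j).2]
  have ux : ⨆ j, (P j).1 ≤ o.1 + Ce o P := ciSup_le fun j => by linarith [(hx j).1]
  have ly : o.2 - Ce o P ≤ ⨅ j, (P j).2 := le_ciInf fun j => by linarith [(hy j).2]
  have uy : ⨆ j, (P j).2 ≤ o.2 + Ce o P := ciSup_le fun j => by linarith [(hy j).1]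
  have sx : ((MBB P oh).1 - o.1) ^ 2 ≤ Ce o P ^ 2 :=
    sq_le_sq' (by linarith [mx.1]) (by linarith [mx.2])
  have sy : ((MBB P oh).2 - o.2) ^ 2 ≤ Ce o P ^ 2 :=
    sq_le_sq' (by linarith [my.1]) (by linarith [my.2])
  apply Real.sqrt_le_iff.2 ⟨by positivity, ?_⟩
  rw [mul_pow, Real.sq_sqrt zero_le_two]
  linarith

/-- refined guarantee of the Minimum Bounding Box mechanism as a
function of the prediction error: its egalitarian cost is at most
OPT + min(dist(prediction, optimum), √2 · OPT). -/
theorem MBB_error_bound (n : ℕ) (hn : 1 ≤ n) (P : Fin n → ℝ × ℝ) (o oh : ℝ × ℝ)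
    (ho : ∀ y : ℝ × ℝ, Ce o P ≤ Ce y P) :
    Ce (MBB P oh) P ≤ Ce o P + min (eudist oh o) (Real.sqrt 2 * Ce o P) := by
  have : Nonempty (Fin n) := ⟨⟨0, hn⟩⟩
  have h : eudist (MBB P oh) o ≤ min (eudist oh o) (Real.sqrt 2 * Ce o P) :=
    le_min (eudist_MBB_le P o oh (MBB_eq_self_of_forall_Ce_le P o ho))
      (eudist_MBB_le_sqrt_two_mul P o oh)
  refine ciSup_le fun i => ?_
  linarith [eudist_triangle (MBB P oh) o (P i), eudist_le_Ce o P i]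
end

section
/- Fix n ≥ 1 and c ∈ [0,1) with cn ∈ ℕ, and let P ∈ (ℝ²)ⁿ. For any two predictions ô, õ ∈ ℝ², the Coordinatewise Median with Predictions mechanism satisfies ‖CMP(P, ô, c) − CMP(P, õ, c)‖ ≤ ‖ô − õ‖ (Euclidean norm); that is, the output is 1-Lipschitz in the prediction. -/
/-- Utilitarian social cost: the average distance from `y` to the points of `P`. -/
noncomputable def Cu {n : ℕ} (y : ℝ × ℝ) (P : Fin n → ℝ × ℝ) : ℝ :=
  (∑ i, eudist y (P i)) / n

/-- The lower median of a multiset of `m` reals: its `⌈m/2⌉`-th smallest element. -/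
noncomputable def lowerMedian (s : Multiset ℝ) : ℝ :=
  (s.sort (· ≤ ·)).getD ((s.card + 1) / 2 - 1) 0

/-- The Coordinatewise Median with Predictions mechanism: the coordinatewise
lower median of the reported points together with `k` copies of the
prediction (where `k = c·n` for confidence `c`). -/
noncomputable def CMP {n : ℕ} (P : Fin n → ℝ × ℝ) (oh : ℝ × ℝ) (k : ℕ) : ℝ × ℝ :=
  (lowerMedian ((↑(List.ofFn fun i => (P i).1) : Multiset ℝ) + Multiset.replicate k oh.1),
   lowerMedian ((↑(List.ofFn fun i => (P i).2) : Multiset ℝ) + Multiset.replicate k oh.2))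

theorem getElem_le_iff_lt_countP_of_pairwise_le {α : Type*} [LinearOrder α] {l : List α}
    (hl : l.Pairwise (· ≤ ·)) (t : α) (i : ℕ) (hi : i < l.length) :
    l[i] ≤ t ↔ i < l.countP (· ≤ t) := by
  induction l generalizing i with
  | nil => simp at hi
  | cons a l ih =>
    obtain ⟨ha, hl⟩ := List.pairwise_cons.mp hl
    by_cases hat : a ≤ t
    · cases i with
      | zero => simp [hat]
      | succ i => simpa [List.countP_cons, hat] using ih hl i (by simpa using hi)
    · have hlt : ∀ b ∈ a :: l, t < b := by
        intro b hb
        rcases List.mem_cons.mp hb with rfl | hb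
        · exact not_le.mp hat
        · exact (not_le.mp hat).trans_le (ha b hb)
      have hcount : (a :: l).countP (· ≤ t) = 0 :=
        List.countP_eq_zero.mpr fun b hb => by simpa using hlt b hb
      rw [hcount]
      simpa using hlt _ (List.getElem_mem hi)

theorem lowerMedian_le_iff {s : Multiset ℝ} (hs : 0 < s.card) (t : ℝ) :
    lowerMedian s ≤ t ↔ (s.card + 1) / 2 ≤ s.countP (· ≤ t) := by
  have hi : (s.card + 1) / 2 - 1 < (s.sort (· ≤ ·)).length := by
    rw [Multiset.length_sort]
    omega
  have hcount : s.countP (· ≤ t) = (s.sort (· ≤ ·)).countP (· ≤ t) := by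
    conv_lhs => rw [← Multiset.sort_eq s (· ≤ ·)]
    exact Multiset.coe_countP _ _
  rw [lowerMedian, List.getD_eq_getElem _ _ hi,
    getElem_le_iff_lt_countP_of_pairwise_le (Multiset.pairwise_sort s _), hcount]
  omega

theorem lowerMedian_add_replicate_le {s : Multiset ℝ} (hs : 0 < s.card) (k : ℕ) {x y d : ℝ}
    (hd : 0 ≤ d) (hxy : x ≤ y + d) :
    lowerMedian (s + Multiset.replicate k x) ≤ lowerMedian (s + Multiset.replicate k y) + d := by
  set m := lowerMedian (s + Multiset.replicate k y) with hm
  have hy := (lowerMedian_le_iff (s := s + Multiset.replicate k y) (by simp; omega) m).mp hm.ge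
  rw [lowerMedian_le_iff (by simp; omega)]
  simp only [Multiset.card_add, Multiset.card_replicate, Multiset.countP_add] at hy ⊢
  refine hy.trans (add_le_add ?_ ?_)
  · simp only [Multiset.countP_eq_card_filter]
    exact Multiset.card_le_card
      (Multiset.monotone_filter_right s fun b hb => by linarith)
  · by_cases h : y ≤ m
    · have h' : x ≤ m + d := by linarith
      simp [← Multiset.coe_replicate, List.countP_replicate, h, h']
    · simp [← Multiset.coe_replicate, List.countP_replicate, h]

theorem abs_lowerMedian_add_replicate_sub_le {s : Multiset ℝ} (hs : 0 < s.card) (k : ℕ)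
    (x y : ℝ) :
    |lowerMedian (s + Multiset.replicate k x) - lowerMedian (s + Multiset.replicate k y)|
      ≤ |x - y| := by
  have hxy := lowerMedian_add_replicate_le hs k (abs_nonneg (x - y))
    (by linarith [le_abs_self (x - y)] : x ≤ y + |x - y|)
  have hyx := lowerMedian_add_replicate_le hs k (abs_nonneg (x - y))
    (by linarith [neg_abs_le (x - y)] : y ≤ x + |x - y|)
  rw [abs_le]
  constructor <;> linarith

/-- the output of CMP is 1-Lipschitz in the prediction. -/
theorem CMP_lipschitz_in_prediction (n : ℕ) (hn : 1 ≤ n) (c : ℝ) (hc0 : 0 ≤ c)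
    (hc1 : c < 1) (k : ℕ) (hk : (k : ℝ) = c * n)
    (P : Fin n → ℝ × ℝ) (oh ot : ℝ × ℝ) :
    eudist (CMP P oh k) (CMP P ot k) ≤ eudist oh ot := by
  exact Real.sqrt_le_sqrt (add_le_add
    (sq_le_sq.mpr (abs_lowerMedian_add_replicate_sub_le (by simp; omega) k _ _))
    (sq_le_sq.mpr (abs_lowerMedian_add_replicate_sub_le (by simp; omega) k _ _)))
end
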